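/- arXiv:1409.1079 — 2 statements merged into one kernel-verified Lean document; each statement's English description precedes it below -/
import Mathlib

section
/- For every p ∈ ℂ and every nonempty open set U ⊆ ℂ, the set X_U := {α ∈ ℝ : there exists z ∈ L_α(p) with exp(exp(z)) ∈ U} has full Lebesgue measure in ℝ, i.e. its complement ℝ \ X_U is a Lebesgue null set. -/
open MeasureTheory Complex

/-- The non-horizontal line through `p` with direction `i + α`. -/
def lineThrough (p : ℂ) (α : ℝ) : Set ℂ :=
  {z : ℂ | ∃ t : ℝ, z = p + (t : ℂ) * (Complex.I + (α : ℂ))}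

open Filter Metric Set Topology

/-- A set of reals that is porous at almost every point is null. -/
lemma volume_eq_zero_of_ae_porous {S : Set ℝ}
    (h : ∀ᵐ x : ℝ, ∃ K : ℝ, ∃ w δ : ℕ → ℝ, Tendsto δ atTop (𝓝[>] 0) ∧
      ∀ᶠ j in atTop, |x - w j| ≤ K * δ j ∧ Disjoint S (closedBall (w j) (δ j))) :
    volume S = 0 := by
  have hd : ∀ᵐ x ∂volume.restrict S, ∀ m : ℕ, ∀ (w δ : ℕ → ℝ),
      Tendsto δ atTop (𝓝[>] 0) → (∀ᶠ j in atTop, x ∈ closedBall (w j) (m * δ j)) →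
      Tendsto (fun j => volume (S ∩ closedBall (w j) (δ j)) / volume (closedBall (w j) (δ j)))
        atTop (𝓝 1) := by
    rw [ae_all_iff]
    intro m
    filter_upwards [IsUnifLocDoublingMeasure.ae_tendsto_measure_inter_div volume S (m : ℝ)]
      with x hx w δ h1 h2
    exact hx w δ h1 h2
  have hF : ∀ᵐ x ∂volume.restrict S, False := by
    filter_upwards [hd, ae_restrict_of_ae h] with x hx ⟨K, w, δ, hδ, hw⟩
    obtain ⟨m, hm⟩ := exists_nat_ge K
    have hpos : ∀ᶠ j in atTop, 0 < δ j := hδ.eventually self_mem_nhdsWithin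
    have h1 := hx m w δ hδ <| by
      filter_upwards [hw, hpos] with j hj hp
      rw [mem_closedBall, Real.dist_eq]
      exact hj.1.trans (by gcongr)
    have h0 : Tendsto (fun j => volume (S ∩ closedBall (w j) (δ j)) /
        volume (closedBall (w j) (δ j))) atTop (𝓝 0) := by
      refine tendsto_const_nhds.congr' ?_
      filter_upwards [hw] with j hj
      simp [hj.2.inter_eq]
    exact zero_ne_one (tendsto_nhds_unique h0 h1)
  rw [← Measure.restrict_eq_zero]
  exact ae_eq_bot.mp (eventually_false_iff_eq_bot.mp hF)

/-- A sequence of reals tending to infinity crosses every level above its first term. -/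
lemma exists_le_and_lt_succ_of_tendsto_atTop {h : ℕ → ℝ} (hh : Tendsto h atTop atTop) {X : ℝ}
    (hX : h 0 ≤ X) : ∃ k, h k ≤ X ∧ X < h (k + 1) := by
  by_contra! H
  have hle : ∀ k, h k ≤ X := fun k => Nat.rec hX (fun k hk => H k hk) k
  obtain ⟨k, hk⟩ := (hh.eventually_gt_atTop X).exists
  exact absurd hk (hle k).not_gt

lemma norm_log_sub_log_le {r : ℝ} (hr : 0 < r) {z w : ℂ} (hz : r ≤ z.im) (hw : r ≤ w.im) :
    ‖log w - log z‖ ≤ r⁻¹ * ‖w - z‖ := by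
  refine (convex_halfSpace_im_ge r).norm_image_sub_le_of_norm_hasDerivWithin_le
    (f' := fun z => z⁻¹) (fun u hu => ?_) (fun u hu => ?_) hz hw
  · have hu' : r ≤ u.im := hu
    exact (hasDerivAt_log (Or.inr (hr.trans_le hu').ne')).hasDerivWithinAt
  · have hu' : r ≤ u.im := hu
    rw [norm_inv]
    gcongr
    exact hu'.trans ((le_abs_self _).trans (abs_im_le_norm u))

/-- The preimages of `exp ℓ` under `exp` obtained by translating `ℓ` upwards. -/
noncomputable def upwardTranslate (ℓ : ℂ) (k : ℕ) : ℂ :=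
  ℓ + (k + 1 : ℕ) * (2 * Real.pi * I)

lemma upwardTranslate_re (ℓ : ℂ) (k : ℕ) : (upwardTranslate ℓ k).re = ℓ.re := by
  simp [upwardTranslate]

lemma upwardTranslate_im (ℓ : ℂ) (k : ℕ) :
    (upwardTranslate ℓ k).im = ℓ.im + (k + 1) * (2 * Real.pi) := by
  simp [upwardTranslate]

lemma le_upwardTranslate_im {ℓ : ℂ} (hℓ : -Real.pi < ℓ.im) (k : ℕ) :
    Real.pi * (k + 1) ≤ (upwardTranslate ℓ k).im := by
  rw [upwardTranslate_im]
  nlinarith [Real.pi_pos, mul_nonneg (Nat.cast_nonneg (α := ℝ) k) Real.pi_pos.le]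

lemma pi_le_upwardTranslate_im {ℓ : ℂ} (hℓ : -Real.pi < ℓ.im) (k : ℕ) :
    Real.pi ≤ (upwardTranslate ℓ k).im :=
  le_trans (by nlinarith [mul_nonneg (Nat.cast_nonneg (α := ℝ) k) Real.pi_pos.le])
    (le_upwardTranslate_im hℓ k)

lemma one_le_norm_upwardTranslate {ℓ : ℂ} (hℓ : -Real.pi < ℓ.im) (k : ℕ) :
    1 ≤ ‖upwardTranslate ℓ k‖ := by
  have h1 := pi_le_upwardTranslate_im hℓ k
  have h2 := (le_abs_self _).trans (abs_im_le_norm (upwardTranslate ℓ k))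
  linarith [Real.pi_gt_three]

lemma tendsto_norm_upwardTranslate {ℓ : ℂ} (hℓ : -Real.pi < ℓ.im) :
    Tendsto (fun k => ‖upwardTranslate ℓ k‖) atTop atTop := by
  refine tendsto_atTop_mono (fun k => ?_) tendsto_natCast_atTop_atTop
  have h1 := le_upwardTranslate_im hℓ k
  have h2 := (le_abs_self _).trans (abs_im_le_norm (upwardTranslate ℓ k))
  nlinarith [Real.pi_gt_three, Nat.cast_nonneg (α := ℝ) k]

lemma exists_norm_log_upwardTranslate_succ_sub_le {ℓ : ℂ} (hℓ : -Real.pi < ℓ.im) :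
    ∃ C : ℝ, 0 ≤ C ∧ ∀ k, ‖log (upwardTranslate ℓ (k + 1)) - log (upwardTranslate ℓ k)‖ ≤
      C / ‖upwardTranslate ℓ k‖ := by
  refine ⟨2 * Real.pi * (|ℓ.re| + 1), by positivity, fun k => ?_⟩
  set y := (upwardTranslate ℓ k).im with hy
  have hpy : Real.pi ≤ y := pi_le_upwardTranslate_im hℓ k
  have hy0 : 0 < y := Real.pi_pos.trans_le hpy
  have hy' : y ≤ (upwardTranslate ℓ (k + 1)).im := by
    rw [hy, upwardTranslate_im, upwardTranslate_im]
    push_cast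
    nlinarith [Real.pi_pos]
  have hsub : upwardTranslate ℓ (k + 1) - upwardTranslate ℓ k = ((2 * Real.pi : ℝ) : ℂ) * I := by
    simp only [upwardTranslate]
    push_cast
    ring
  have hnorm : ‖upwardTranslate ℓ (k + 1) - upwardTranslate ℓ k‖ = 2 * Real.pi := by
    rw [hsub, norm_mul, norm_I, mul_one, norm_real, Real.norm_of_nonneg (by positivity)]
  have h1 := norm_log_sub_log_le hy0 le_rfl hy'
  rw [hnorm] at h1
  refine h1.trans ?_
  have hW : ‖upwardTranslate ℓ k‖ ≤ (|ℓ.re| + 1) * y := by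
    refine (norm_le_abs_re_add_abs_im _).trans ?_
    rw [upwardTranslate_re, ← hy, abs_of_pos hy0]
    nlinarith [abs_nonneg ℓ.re, Real.pi_gt_three]
  have hW1 := one_le_norm_upwardTranslate hℓ k
  rw [le_div_iff₀ (by linarith), inv_mul_eq_div, div_mul_eq_mul_div, div_le_iff₀ hy0]
  calc 2 * Real.pi * ‖upwardTranslate ℓ k‖ ≤ 2 * Real.pi * ((|ℓ.re| + 1) * y) := by gcongr
    _ = _ := by ring

/-- A direction for which `log ‖W‖` nearly equals the real part of the point of the line whose
imaginary part is an argument of `W` yields a point of the line that `exp` maps close to `W`. -/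
lemma exists_mem_lineThrough_exp_mem_ball {p W : ℂ} {α T δ : ℝ} {n : ℤ} (hW : W ≠ 0)
    (hT : T = arg W + 2 * Real.pi * n - p.im) (h1 : |α * T + p.re - Real.log ‖W‖| ≤ 1)
    (h2 : ‖W‖ * (2 * |α * T + p.re - Real.log ‖W‖|) < δ) :
    ∃ z ∈ lineThrough p α, exp z ∈ ball W δ := by
  refine ⟨p + (T : ℂ) * (I + α), ⟨T, rfl⟩, ?_⟩
  set s := α * T + p.re - Real.log ‖W‖ with hs
  have hz : p + (T : ℂ) * (I + α) = log W + s + n * (2 * Real.pi * I) := by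
    apply Complex.ext
    · simp [hs, log_re]
      ring
    · simp [log_im, hT]
      ring
  rw [hz, exp_add, exp_int_mul_two_pi_mul_I, mul_one, exp_add, exp_log hW, mem_ball, dist_eq_norm]
  have h3 : ‖exp (s : ℂ) - 1‖ ≤ 2 * ‖(s : ℂ)‖ :=
    norm_exp_sub_one_le (by rwa [norm_real, Real.norm_eq_abs])
  rw [norm_real, Real.norm_eq_abs] at h3
  calc ‖W * exp s - W‖ = ‖W‖ * ‖exp (s : ℂ) - 1‖ := by rw [← norm_mul, mul_sub, mul_one]
    _ ≤ ‖W‖ * (2 * |s|) := by gcongr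
    _ < δ := h2

lemma exists_porosity_balls (p : ℂ) {ℓ : ℂ} (hℓ : -Real.pi < ℓ.im) {δ : ℝ} (hδ : 0 < δ)
    {α₀ : ℝ} (hα₀ : α₀ ≠ 0) :
    ∃ K : ℝ, ∃ w ρ : ℕ → ℝ, Tendsto ρ atTop (𝓝[>] 0) ∧ ∀ᶠ j in atTop, |α₀ - w j| ≤ K * ρ j ∧
      ∀ α ∈ closedBall (w j) (ρ j), ∃ z ∈ lineThrough p α, ∃ k, exp z ∈
        ball (upwardTranslate ℓ k) δ := by
  obtain ⟨C, hC0, hC⟩ := exists_norm_log_upwardTranslate_succ_sub_le hℓ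
  set W := upwardTranslate ℓ with hWdef
  have hW1 : ∀ k, 1 ≤ ‖W k‖ := one_le_norm_upwardTranslate hℓ
  set c : ℂ := 1 + α₀ * I with hc
  set h : ℕ → ℝ := fun k => Real.log ‖W k‖ - α₀ * arg (W k) with hh
  have hre : ∀ k, h k = (c * log (W k)).re := fun k => by
    simp [hh, hc, log_re, log_im]
  have hstep : ∀ k, h (k + 1) - h k ≤ ‖c‖ * C / ‖W k‖ := fun k => by
    rw [hre, hre, ← sub_re, ← mul_sub, mul_div_assoc]
    refine (re_le_norm _).trans ?_
    rw [norm_mul]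
    gcongr
    exact hC k
  have htend : Tendsto h atTop atTop := by
    refine tendsto_atTop_mono (fun k => ?_) (tendsto_atTop_add_const_right _ (-(|α₀| * Real.pi))
      (Real.tendsto_log_atTop.comp (tendsto_norm_upwardTranslate hℓ)))
    have : α₀ * arg (W k) ≤ |α₀| * Real.pi := by
      refine (le_abs_self _).trans ?_
      rw [abs_mul]
      gcongr
      exact abs_arg_le_pi _
    simp only [Function.comp, hh]
    linarith
  obtain ⟨σ, hσ, hσα⟩ : ∃ σ : ℤ, (σ = 1 ∨ σ = -1) ∧ 0 < α₀ * σ := by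
    rcases lt_or_gt_of_ne hα₀ with h0 | h0
    · exact ⟨-1, Or.inr rfl, by simpa using h0⟩
    · exact ⟨1, Or.inl rfl, by simpa using h0⟩
  have hX : Tendsto (fun j : ℕ => α₀ * (2 * Real.pi * ((σ * j : ℤ) : ℝ) - p.im) + p.re)
      atTop atTop := by
    have := tendsto_atTop_add_const_right atTop (p.re - α₀ * p.im)
      ((tendsto_natCast_atTop_atTop (R := ℝ)).const_mul_atTop
        (mul_pos hσα Real.two_pi_pos))
    refine this.congr fun j => ?_
    push_cast
    ring
  have hk : ∀ j : ℕ, ∃ k, h 0 ≤ α₀ * (2 * Real.pi * ((σ * j : ℤ) : ℝ) - p.im) + p.re →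
      h k ≤ α₀ * (2 * Real.pi * ((σ * j : ℤ) : ℝ) - p.im) + p.re ∧
      α₀ * (2 * Real.pi * ((σ * j : ℤ) : ℝ) - p.im) + p.re < h (k + 1) := fun j => by
    by_cases hj : h 0 ≤ α₀ * (2 * Real.pi * ((σ * j : ℤ) : ℝ) - p.im) + p.re
    · obtain ⟨k, hk⟩ := exists_le_and_lt_succ_of_tendsto_atTop htend hj
      exact ⟨k, fun _ => hk⟩
    · exact ⟨0, fun h => absurd h hj⟩
  choose k hk using hk
  set T : ℕ → ℝ := fun j => arg (W (k j)) + 2 * Real.pi * ((σ * j : ℤ) : ℝ) - p.im with hT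
  have hTtend : Tendsto (fun j => |T j|) atTop atTop := by
    have h1 := tendsto_atTop_add_const_right atTop (-(Real.pi + |p.im|))
      ((tendsto_natCast_atTop_atTop (R := ℝ)).const_mul_atTop Real.two_pi_pos)
    refine tendsto_atTop_mono (fun j => ?_) h1
    have ha := abs_le.mp (abs_arg_le_pi (W (k j)))
    have hb := abs_le.mp (le_refl |p.im|)
    rcases hσ with rfl | rfl
    · refine le_trans ?_ (le_abs_self _)
      simp only [hT]
      push_cast
      linarith
    · refine le_trans ?_ (neg_le_abs _)
      simp only [hT]
      push_cast
      linarith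
  set η : ℝ := min 1 (δ / 4) with hη
  have hη0 : 0 < η := by positivity
  have hTpos : ∀ᶠ j in atTop, 0 < |T j| := hTtend.eventually_gt_atTop 0
  have hρpos : ∀ᶠ j in atTop, 0 < η / (‖W (k j)‖ * |T j|) := by
    filter_upwards [hTpos] with j hj
    have := hW1 (k j)
    positivity
  refine ⟨‖c‖ * C / η, fun j => (Real.log ‖W (k j)‖ - p.re) / T j,
    fun j => η / (‖W (k j)‖ * |T j|), ?_, ?_⟩
  · rw [tendsto_nhdsWithin_iff]
    refine ⟨?_, hρpos⟩
    refine tendsto_const_nhds.div_atTop (tendsto_atTop_mono (fun j => ?_) hTtend)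
    exact le_mul_of_one_le_left (abs_nonneg _) (hW1 _)
  · filter_upwards [hTpos, hX.eventually_ge_atTop (h 0)] with j hj hXj
    have hW0 : 0 < ‖W (k j)‖ := zero_lt_one.trans_le (hW1 _)
    have hTj : T j ≠ 0 := abs_pos.mp hj
    have hsub : ∀ α : ℝ, |α - (Real.log ‖W (k j)‖ - p.re) / T j| =
        |α * T j + p.re - Real.log ‖W (k j)‖| / |T j| := fun α => by
      rw [← abs_div]
      congr 1
      field_simp
      ring
    constructor
    · obtain ⟨hk1, hk2⟩ := hk j hXj
      have hs := hstep (k j)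
      have hval : α₀ * T j + p.re - Real.log ‖W (k j)‖ =
          α₀ * (2 * Real.pi * ((σ * j : ℤ) : ℝ) - p.im) + p.re - h (k j) := by
        simp only [hT, hh]
        ring
      rw [hsub, hval, abs_of_nonneg (by linarith)]
      have : ‖c‖ * C / η * (η / (‖W (k j)‖ * |T j|)) = ‖c‖ * C / ‖W (k j)‖ / |T j| := by
        field_simp
      rw [this]
      gcongr
      linarith
    · intro α hα
      rw [mem_closedBall, Real.dist_eq, hsub, div_le_iff₀ hj] at hα
      have hα' : |α * T j + p.re - Real.log ‖W (k j)‖| ≤ η / ‖W (k j)‖ := by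
        refine hα.trans_eq ?_
        field_simp
      have hle : ‖W (k j)‖ * |α * T j + p.re - Real.log ‖W (k j)‖| ≤ η := by
        rwa [le_div_iff₀ hW0, mul_comm] at hα'
      obtain ⟨z, hz, hzW⟩ := exists_mem_lineThrough_exp_mem_ball (p := p) (δ := δ) (α := α)
        (T := T j) (n := σ * j) (norm_pos_iff.mp hW0) rfl
        (hα'.trans ((div_le_self hη0.le (hW1 _)).trans (min_le_left _ _)))
        (by linarith [min_le_right 1 (δ / 4)])
      exact ⟨z, hz, k j, hzW⟩

/-- For every `p ∈ ℂ` and nonempty open `U ⊆ ℂ`, the set of `α ∈ ℝ` whose line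
`L_α(p)` meets `U` under `exp ∘ exp` has full Lebesgue measure. -/
theorem expexp_hits_open_set_full_measure (p : ℂ) (U : Set ℂ) (hU : IsOpen U)
    (hUne : U.Nonempty) :
    volume {α : ℝ | ∃ z ∈ lineThrough p α, Complex.exp (Complex.exp z) ∈ U}ᶜ = 0 := by
  obtain ⟨u, huU, hu0⟩ := (dense_compl_singleton (0 : ℂ)).inter_open_nonempty U hU hUne
  have hmem : exp (log u) ∈ U := by rwa [exp_log hu0]
  obtain ⟨δ, hδ, hball⟩ := Metric.isOpen_iff.mp (hU.preimage continuous_exp) (log u) hmem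
  refine volume_eq_zero_of_ae_porous ?_
  filter_upwards [Measure.ae_ne volume (0 : ℝ)] with α₀ hα₀
  obtain ⟨K, w, ρ, hρ, hw⟩ := exists_porosity_balls p (neg_pi_lt_log_im u) hδ hα₀
  refine ⟨K, w, ρ, hρ, hw.mono fun j hj => ⟨hj.1, ?_⟩⟩
  rw [disjoint_compl_left_iff_subset]
  intro α hα
  obtain ⟨z, hz, k, hzk⟩ := hj.2 α hα
  refine ⟨z, hz, ?_⟩
  have hz' : exp z - (k + 1 : ℕ) * (2 * Real.pi * I) ∈ ball (log u) δ := by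
    rw [mem_ball, dist_eq_norm] at hzk ⊢
    rwa [sub_sub, add_comm, ← upwardTranslate]
  have := hball hz'
  rwa [mem_preimage, exp_sub, exp_nat_mul_two_pi_mul_I, div_one] at this
end

section
/- Let a ∈ (0,1) be a real number with the property that for every finite string (s_1,…,s_m) of binary digits there is a position in the binary expansion of a at which the digits s_1,…,s_m occur consecutively. Then for every k₀ ∈ ℕ, the set of fractional parts {2^k·a − ⌊2^k·a⌋ : k ≥ k₀} is dense in [0,1]. -/
/-- Multiplying by `b ^ k` shifts a base-`b` expansion by `k` places, up to an integer. -/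
theorem Real.fract_pow_mul_ofDigits {b : ℕ} (x : ℕ → Fin b) (k : ℕ)
    (h : Real.ofDigits (fun i ↦ x (i + k)) < 1) :
    Int.fract ((b : ℝ) ^ k * Real.ofDigits x) = Real.ofDigits (fun i ↦ x (i + k)) := by
  have hb : (b : ℝ) ≠ 0 := Nat.cast_ne_zero.2 (Fin.pos (x 0)).ne'
  rw [Int.fract_eq_iff]
  refine ⟨Real.ofDigits_nonneg _, h, ∑ i ∈ Finset.range k, (x i : ℕ) * b ^ (k - 1 - i), ?_⟩
  rw [Real.ofDigits_eq_sum_add_ofDigits x k, mul_add, mul_inv_cancel_left₀ (pow_ne_zero k hb),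
    add_sub_cancel_right, Finset.mul_sum]
  push_cast
  refine Finset.sum_congr rfl fun i hi ↦ ?_
  have hk : k = (k - 1 - i) + (i + 1) := by have := Finset.mem_range.1 hi; omega
  rw [Real.ofDigitsTerm, mul_left_comm]
  congr 1
  nth_rw 1 [hk]
  rw [pow_add, mul_assoc, mul_inv_cancel₀ (pow_ne_zero _ hb), mul_one]

/-- If `a ∈ (0,1)` has a binary expansion containing every finite string of
binary digits, then for every `k₀` the set of fractional parts of `2^k a`,
`k ≥ k₀`, is dense in `[0,1]`. -/
theorem fract_two_pow_mul_dense (a : ℝ) (ha : a ∈ Set.Ioo (0 : ℝ) 1)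
    (d : ℕ → ℕ) (hd : ∀ k, d k = 0 ∨ d k = 1)
    (hsum : a = ∑' k : ℕ, (d k : ℝ) / 2 ^ (k + 1))
    (hstrings : ∀ m : ℕ, ∀ s : Fin m → ℕ, (∀ i, s i = 0 ∨ s i = 1) →
      ∃ j : ℕ, ∀ i : Fin m, d (j + (i : ℕ)) = s i)
    (k₀ : ℕ) :
    Set.Icc (0 : ℝ) 1 ⊆
      closure {x : ℝ | ∃ k : ℕ, k₀ ≤ k ∧ Int.fract (2 ^ k * a) = x} := by
  let x : ℕ → Fin 2 := fun k ↦ ⟨d k, by have := hd k; omega⟩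
  have hax : a = Real.ofDigits x := by
    rw [hsum, Real.ofDigits]
    exact tsum_congr fun k ↦ by simp [Real.ofDigitsTerm, x, div_eq_mul_inv]
  rw [← closure_Ico (zero_ne_one' ℝ)]
  refine closure_minimal (fun y hy ↦ Metric.mem_closure_iff.2 fun ε hε ↦ ?_) isClosed_closure
  obtain ⟨e, -, rfl⟩ := Real.ofDigits_SurjOn one_lt_two (Set.Ico_subset_Icc_self hy)
  obtain ⟨n, hn⟩ := exists_pow_lt_of_lt_one (lt_min hε (sub_pos.2 hy.2))
    (by norm_num : (2⁻¹ : ℝ) < 1)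
  -- Padding the string with `k₀` zeros forces its tail to occur at a position at least `k₀`.
  obtain ⟨j, hj⟩ := hstrings (k₀ + n) (fun i ↦ if (i : ℕ) < k₀ then 0 else e (i - k₀))
    (fun i ↦ by split_ifs <;> omega)
  have hclose := Real.abs_ofDigits_sub_ofDigits_le (x := e) (y := fun i ↦ x (i + (j + k₀)))
    (n := n) fun i hi ↦ by
      have := hj ⟨k₀ + i, by omega⟩
      simp only [add_lt_iff_neg_left, not_lt_zero, if_false, add_tsub_cancel_left] at this
      ext
      rw [← this]
      simp only [x]
      congr 1
      omega
  rw [← inv_pow, Nat.cast_ofNat] at hclose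
  have hlt := hclose.trans_lt hn
  refine ⟨_, ⟨j + k₀, Nat.le_add_left _ _, rfl⟩, ?_⟩
  have := Real.fract_pow_mul_ofDigits x (j + k₀)
    (by linarith [neg_abs_le (Real.ofDigits e - Real.ofDigits fun i ↦ x (i + (j + k₀))),
      hlt.trans_le (min_le_right _ _)])
  rw [Nat.cast_ofNat] at this
  rw [hax, this, Real.dist_eq]
  exact hlt.trans_le (min_le_left _ _)
end
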